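/- Under the assumptions of the previous sampling lemma applied with both labels: with m i.i.d. samples, the plug-in estimator ᾱ = (Σᵢ h(xᵢ)1[yᵢ=−1])/(Σᵢ 1[yᵢ=−1]) − (Σᵢ h(xᵢ)1[yᵢ=1])/(Σᵢ 1[yᵢ=1]) of α* = E[h(x)|y=−1] − E[h(x)|y=1] satisfies E[(ᾱ − α*)²] ≤ 2(σ² + C)/(m·p(1−p)), where C = (2/ln(1/max(p,1−p)))·max(p,1−p)^{1/ln(1/max(p,1−p))}. -/

import Mathlib

open MeasureTheory ProbabilityTheory

lemma aux_cond {X : Type*} [MeasurableSpace X] (ν : Measure (X × ℤ)) (c : ℤ) (g : X × ℤ → ℝ) (r : ℝ) (hr : 0 < r)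
    (hp : (ν {z | z.2 = c}).toReal = r) :
    ∫ z, (if z.2 = c then g z else 0) ∂ν = r * ∫ z, g z ∂(ν[|{z | z.2 = c}]) := by
  have hms : MeasurableSet {z : X × ℤ | z.2 = c} := measurable_snd (measurableSet_singleton c)
  rw [ProbabilityTheory.cond, integral_smul_measure, ENNReal.toReal_inv, hp, smul_eq_mul,
    ← mul_assoc, mul_inv_cancel₀ hr.ne', one_mul, ← integral_indicator hms]
  refine integral_congr_ae (.of_forall fun z => ?_)
  by_cases hz : z.2 = c <;> simp [Set.indicator, hz]

lemma aux_side {X : Type*} [MeasurableSpace X] (ν : Measure (X × ℤ)) [IsProbabilityMeasure ν]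
    (h : X → ℝ) (hh : Measurable h) (hh0 : ∀ t, 0 ≤ h t) (hh1 : ∀ t, h t ≤ 1)
    (c : ℤ) (r σ μ' : ℝ) (hr : 0 < r) (hp : (ν {z | z.2 = c}).toReal = r)
    (hμ : μ' = ∫ z, h z.1 ∂(ν[|{z | z.2 = c}]))
    (hvar : ∫ z, (h z.1 - μ') ^ 2 ∂(ν[|{z | z.2 = c}]) ≤ σ ^ 2) :
    0 ≤ μ' ∧ μ' ≤ 1 ∧ ∫ z, (if z.2 = c then h z.1 - μ' else 0) ∂ν = 0 ∧
    ∫ z, (if z.2 = c then (h z.1 - μ') ^ 2 else 0) ∂ν ≤ r * σ ^ 2 ∧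
    ∫ z, (if z.2 = c then (1 : ℝ) else 0) ∂ν = r := by
  have hne : ν {z | z.2 = c} ≠ 0 := by
    intro h0; rw [h0] at hp; simp at hp; linarith
  have := cond_isProbabilityMeasure hne
  have hint : Integrable (fun z : X × ℤ => h z.1) (ν[|{z | z.2 = c}]) := by
    refine Integrable.of_bound (hh.comp measurable_fst).aestronglyMeasurable 1 (.of_forall fun z => ?_)
    rw [Real.norm_eq_abs, abs_le]; constructor <;> linarith [hh0 z.1, hh1 z.1]
  refine ⟨?_, ?_, ?_, ?_, ?_⟩
  · rw [hμ]; exact integral_nonneg fun z => hh0 _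
  · rw [hμ]
    calc _ ≤ ∫ z, (1 : ℝ) ∂(ν[|{z | z.2 = c}]) := integral_mono hint (integrable_const _) fun z => hh1 _
      _ = 1 := by simp
  · rw [aux_cond ν c (fun z => h z.1 - μ') r hr hp, integral_sub hint (integrable_const _), ← hμ]
    simp
  · rw [aux_cond ν c (fun z => (h z.1 - μ') ^ 2) r hr hp]
    exact mul_le_mul_of_nonneg_left hvar hr.le
  · rw [aux_cond ν c (fun z => 1) r hr hp]; simp

lemma aux_second {Ω : Type*} [MeasurableSpace Ω] (ν : Measure Ω) [IsProbabilityMeasure ν] (m : ℕ)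
    (f : Ω → ℝ) (hf : MemLp f 2 ν) (h0 : ∫ z, f z ∂ν = 0) :
    Integrable (fun ω : Fin m → Ω => (∑ i, f (ω i)) ^ 2) (Measure.pi fun _ => ν) ∧
    ∫ ω : Fin m → Ω, (∑ i, f (ω i)) ^ 2 ∂(Measure.pi fun _ => ν) = m * ∫ z, f z ^ 2 ∂ν := by
  have hL : ∀ i, MemLp (fun ω : Fin m → Ω => f (ω i)) 2 (Measure.pi fun _ => ν) := fun i =>
    hf.comp_measurePreserving (measurePreserving_eval (fun _ => ν) i)
  have hS : MemLp (fun ω : Fin m → Ω => ∑ i, f (ω i)) 2 (Measure.pi fun _ => ν) :=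
    memLp_finsetSum _ fun i _ => hL i
  refine ⟨hS.integrable_sq, ?_⟩
  have hz : ∫ ω : Fin m → Ω, ∑ i, f (ω i) ∂(Measure.pi fun _ => ν) = 0 := by
    rw [integral_finsetSum _ fun i _ => (hL i).integrable one_le_two]
    refine Finset.sum_eq_zero fun i _ => ?_
    rw [integral_comp_eval (μ := fun _ : Fin m => ν) hf.1, h0]
  have hv := variance_sum_pi (μ := fun _ : Fin m => ν) (X := fun _ => f) fun _ => hf
  have e : (∑ i : Fin m, fun ω : Fin m → Ω ↦ f (ω i)) = fun ω => ∑ i, f (ω i) := by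
    ext ω; simp
  rw [e, variance_of_integral_eq_zero hS.1.aemeasurable hz] at hv
  rw [hv]
  simp [variance_of_integral_eq_zero hf.1.aemeasurable h0]

lemma aux_C (p : ℝ) (hp0 : 0 < p) (hp1 : p < 1) :
    1 ≤ (2 / Real.log (1 / max p (1 - p))) * (max p (1 - p)) ^ (1 / Real.log (1 / max p (1 - p))) := by
  set q := max p (1 - p) with hq
  have hq1 : q < 1 := max_lt hp1 (by linarith)
  have hq2 : 1 / 2 ≤ q := by
    rcases le_total p (1/2) with h | h
    · exact le_trans (by linarith) (le_max_right _ _)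
    · exact le_trans h (le_max_left _ _)
  have hL : 0 < Real.log (1 / q) := Real.log_pos (by rw [lt_div_iff₀ (by linarith)]; linarith)
  have hL2 : Real.log (1 / q) ≤ Real.log 2 :=
    Real.log_le_log (by positivity) (by rw [div_le_iff₀ (by linarith)]; linarith)
  have hpow : q ^ (1 / Real.log (1 / q)) = Real.exp (-1) := by
    rw [Real.rpow_def_of_pos (by linarith)]
    congr 1
    have : Real.log q = - Real.log (1 / q) := by simp
    rw [this]; field_simp
  rw [hpow, Real.exp_neg, div_mul_eq_mul_div, le_div_iff₀ hL, one_mul, ← div_eq_mul_inv,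
    le_div_iff₀ (Real.exp_pos _)]
  have h1 := Real.exp_one_lt_d9
  have h2 := Real.log_two_lt_d9
  have h3 := Real.exp_pos 1
  nlinarith

lemma aux_avg (m : ℕ) (b : Fin m → Prop) [DecidablePred b] (x : Fin m → ℝ) (A μ : ℝ)
    (h0 : ∀ i, 0 ≤ x i) (h1 : ∀ i, x i ≤ 1) (hμ0 : 0 ≤ μ) (hμ1 : μ ≤ 1)
    (hA : (∑ i, (if b i then (1 : ℝ) else 0)) ≠ 0 →
      A = (∑ i, (if b i then x i else 0)) / (∑ i, (if b i then (1 : ℝ) else 0)))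
    (hA0 : (∑ i, (if b i then (1 : ℝ) else 0)) = 0 → 0 ≤ A ∧ A ≤ 1) :
    |A - μ| ≤ 1 ∧
    ∑ i, (if b i then x i - μ else 0) = (∑ i, (if b i then (1 : ℝ) else 0)) * (A - μ) := by
  have hs : ∑ i, (if b i then x i - μ else 0)
      = ∑ i, (if b i then x i else 0) - (∑ i, (if b i then (1 : ℝ) else 0)) * μ := by
    rw [Finset.sum_mul, ← Finset.sum_sub_distrib]
    refine Finset.sum_congr rfl fun i _ => ?_
    split_ifs <;> simp
  have hx0 : 0 ≤ ∑ i, (if b i then x i else 0) :=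
    Finset.sum_nonneg fun i _ => by split_ifs <;> simp [h0]
  have hx1 : ∑ i, (if b i then x i else 0) ≤ ∑ i, (if b i then (1 : ℝ) else 0) :=
    Finset.sum_le_sum fun i _ => by split_ifs <;> simp [h1]
  rw [hs]
  generalize (∑ i, (if b i then (1 : ℝ) else 0)) = N at *
  generalize (∑ i, (if b i then x i else 0)) = S at *
  by_cases hN : N = 0
  · obtain ⟨a, c⟩ := hA0 hN
    subst hN
    refine ⟨abs_le.2 ⟨by linarith, by linarith⟩, ?_⟩
    have : S = 0 := le_antisymm hx1 hx0
    simp [this]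
  · have hN' : 0 < N := lt_of_le_of_ne (hx0.trans hx1) (Ne.symm hN)
    have e := hA hN
    have a0 : 0 ≤ A := by rw [e]; positivity
    have a1 : A ≤ 1 := by rw [e, div_le_one hN']; exact hx1
    refine ⟨abs_le.2 ⟨by linarith, by linarith⟩, ?_⟩
    have : A * N = S := by rw [e]; field_simp
    linarith

lemma aux_alg (m p a b N M : ℝ) (hp0 : 0 < p) (hp1 : p < 1) (ha : |a| ≤ 1) (hb : |b| ≤ 1)
    (hM : M = m - N) :
    m ^ 2 * (a - b) ^ 2 ≤ 2 * (M * a / (1 - p) - N * b / p) ^ 2 +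
      2 / (p * (1 - p)) ^ 2 * (N - m * p) ^ 2 := by
  have hq : 0 < 1 - p := by linarith
  set s := M * a / (1 - p) - N * b / p with hs
  have key : m * (a - b) = s + (N - m * p) / (p * (1 - p)) * (p * a + (1 - p) * b) := by
    rw [hs, hM]; field_simp; ring
  have hc : |p * a + (1 - p) * b| ≤ 1 := by
    rw [abs_le] at *
    constructor <;> nlinarith
  have hc2 : (p * a + (1 - p) * b) ^ 2 ≤ 1 := by
    rw [← sq_abs]; nlinarith [abs_nonneg (p * a + (1 - p) * b)]
  have e : 2 / (p * (1 - p)) ^ 2 * (N - m * p) ^ 2 = 2 * ((N - m * p) / (p * (1 - p))) ^ 2 := by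
    field_simp
  rw [← mul_pow, key, e]
  generalize (N - m * p) / (p * (1 - p)) = t
  generalize p * a + (1 - p) * b = u at *
  nlinarith [sq_nonneg (s - t * u), mul_le_mul_of_nonneg_left hc2 (sq_nonneg t)]

/-- Mean-squared-error bound for the plug-in estimator `ᾱ` of
`α* = E[h(x)|y=−1] − E[h(x)|y=1]` from `m` i.i.d. samples:
`E[(ᾱ − α*)²] ≤ 2(σ² + C)/(m p (1−p))` with
`C = (2/ln(1/max(p,1−p))) max(p,1−p)^{1/ln(1/max(p,1−p))}`. -/
theorem stmt_9 {X : Type*} [MeasurableSpace X] (ν : Measure (X × ℤ)) [IsProbabilityMeasure ν]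
    (m : ℕ) (hm : 1 ≤ m) (h : X → ℝ) (hh : Measurable h)
    (hh0 : ∀ t, 0 ≤ h t) (hh1 : ∀ t, h t ≤ 1)
    (p σ : ℝ) (hp0 : 0 < p) (hp1 : p < 1)
    (hp : (ν {z | z.2 = 1}).toReal = p)
    (hq : (ν {z | z.2 = -1}).toReal = 1 - p)
    (μpos μneg : ℝ)
    (hμpos : μpos = ∫ z, h z.1 ∂(ν[|{z | z.2 = 1}]))
    (hμneg : μneg = ∫ z, h z.1 ∂(ν[|{z | z.2 = -1}]))
    (hvarpos : ∫ z, (h z.1 - μpos) ^ 2 ∂(ν[|{z | z.2 = 1}]) ≤ σ ^ 2)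
    (hvarneg : ∫ z, (h z.1 - μneg) ^ 2 ∂(ν[|{z | z.2 = -1}]) ≤ σ ^ 2)
    (Apos Aneg : (Fin m → X × ℤ) → ℝ)
    (hApos : ∀ ω : Fin m → X × ℤ,
        (∑ i, (if (ω i).2 = 1 then (1 : ℝ) else 0)) ≠ 0 →
        Apos ω = (∑ i, (if (ω i).2 = 1 then h (ω i).1 else 0))
            / (∑ i, (if (ω i).2 = 1 then (1 : ℝ) else 0)))
    (hApos0 : ∀ ω : Fin m → X × ℤ,
        (∑ i, (if (ω i).2 = 1 then (1 : ℝ) else 0)) = 0 → 0 ≤ Apos ω ∧ Apos ω ≤ 1)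
    (hAneg : ∀ ω : Fin m → X × ℤ,
        (∑ i, (if (ω i).2 = -1 then (1 : ℝ) else 0)) ≠ 0 →
        Aneg ω = (∑ i, (if (ω i).2 = -1 then h (ω i).1 else 0))
            / (∑ i, (if (ω i).2 = -1 then (1 : ℝ) else 0)))
    (hAneg0 : ∀ ω : Fin m → X × ℤ,
        (∑ i, (if (ω i).2 = -1 then (1 : ℝ) else 0)) = 0 → 0 ≤ Aneg ω ∧ Aneg ω ≤ 1)
    (alphabar : (Fin m → X × ℤ) → ℝ) (hameas : Measurable alphabar)
    (halpha : ∀ ω, alphabar ω = Aneg ω - Apos ω) :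
    ∫ ω, (alphabar ω - (μneg - μpos)) ^ 2 ∂(Measure.pi fun _ : Fin m => ν)
      ≤ 2 * (σ ^ 2 + (2 / Real.log (1 / max p (1 - p)))
            * (max p (1 - p)) ^ (1 / Real.log (1 / max p (1 - p))))
          / (m * p * (1 - p)) := by
  have hq0 : 0 < 1 - p := by linarith
  have hm0 : (0 : ℝ) < m := by exact_mod_cast hm
  obtain ⟨hP0, hP1, hPi, hPv, hPn⟩ := aux_side ν h hh hh0 hh1 1 p σ μpos hp0 hp hμpos hvarpos
  obtain ⟨hN0, hN1, hNi, hNv, hNn⟩ := aux_side ν h hh hh0 hh1 (-1) (1 - p) σ μneg hq0 hq hμneg hvarneg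
  have hms : ∀ c : ℤ, MeasurableSet {z : X × ℤ | z.2 = c} := fun c =>
    measurable_snd (measurableSet_singleton c)
  have hmeas : ∀ (c : ℤ) (g : X → ℝ), Measurable g →
      Measurable (fun z : X × ℤ => if z.2 = c then g z.1 else 0) := fun c g hg =>
    Measurable.ite (hms c) (hg.comp measurable_fst) measurable_const
  have hL : ∀ (c : ℤ) (g : X → ℝ), Measurable g → (∀ t, |g t| ≤ 1) →
      ∀ e : ENNReal, MemLp (fun z : X × ℤ => if z.2 = c then g z.1 else 0) e ν := by
    intro c g hg hb e
    refine MemLp.of_bound (hmeas c g hg).aestronglyMeasurable 1 (.of_forall fun z => ?_)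
    rw [Real.norm_eq_abs]
    split_ifs
    · exact hb _
    · simp
  have hbp : ∀ t, |h t - μpos| ≤ 1 := fun t =>
    abs_le.2 ⟨by linarith [hh0 t], by linarith [hh1 t]⟩
  have hbn : ∀ t, |h t - μneg| ≤ 1 := fun t =>
    abs_le.2 ⟨by linarith [hh0 t], by linarith [hh1 t]⟩
  have hUp := hL 1 (fun t => h t - μpos) (by fun_prop) hbp
  have hUn := hL (-1) (fun t => h t - μneg) (by fun_prop) hbn
  have hVp := hL 1 (fun t => (h t - μpos) ^ 2) (by fun_prop)
    (fun t => by rw [abs_pow]; exact pow_le_one₀ (abs_nonneg _) (hbp t))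
  have hVn := hL (-1) (fun t => (h t - μneg) ^ 2) (by fun_prop)
    (fun t => by rw [abs_pow]; exact pow_le_one₀ (abs_nonneg _) (hbn t))
  have hIp := hL 1 (fun t => 1) (by fun_prop) (by simp)
  have hIn := hL (-1) (fun t => 1) (by fun_prop) (by simp)
  -- labels
  have hae : ∀ᵐ z ∂ν, (if z.2 = -1 then (1 : ℝ) else 0) = 1 - (if z.2 = 1 then (1 : ℝ) else 0) := by
    have hnn : 0 ≤ᵐ[ν] fun z : X × ℤ => 1 - (if z.2 = 1 then (1 : ℝ) else 0)
        - (if z.2 = -1 then (1 : ℝ) else 0) := by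
      refine .of_forall fun z => ?_
      by_cases h1 : z.2 = 1
      · simp [h1]
      · simp only [h1, if_false, Pi.zero_apply]; split_ifs <;> simp
    have hi1 : Integrable (fun z : X × ℤ => 1 - (if z.2 = 1 then (1 : ℝ) else 0)) ν :=
      (integrable_const 1).sub ((hIp 1).integrable le_rfl)
    have hi2 := hi1.sub ((hIn 1).integrable le_rfl)
    have := (integral_eq_zero_iff_of_nonneg_ae hnn hi2).1 (by
      rw [integral_sub hi1 ((hIn 1).integrable le_rfl),
        integral_sub (integrable_const 1) ((hIp 1).integrable le_rfl), hPn, hNn]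
      simp)
    filter_upwards [this] with z hz
    simp only [Pi.zero_apply] at hz
    linarith
  have haepi : ∀ᵐ ω ∂(Measure.pi fun _ : Fin m => ν), ∀ i, (if (ω i).2 = -1 then (1 : ℝ) else 0)
      = 1 - (if (ω i).2 = 1 then (1 : ℝ) else 0) := by
    rw [ae_all_iff]
    intro i
    exact (measurePreserving_eval (fun _ : Fin m => ν) i).quasiMeasurePreserving.ae hae
  -- xi
  set ξ : X × ℤ → ℝ := fun z => (if z.2 = -1 then h z.1 - μneg else 0) / (1 - p)
    - (if z.2 = 1 then h z.1 - μpos else 0) / p with hξ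
  set δ : X × ℤ → ℝ := fun z => (if z.2 = 1 then (1 : ℝ) else 0) - p with hδ
  have hξL : MemLp ξ 2 ν := by
    have := ((hUn 2).mul_const (1 - p)⁻¹).sub ((hUp 2).mul_const p⁻¹)
    simp only [hξ, div_eq_mul_inv]
    exact this
  have hδL : MemLp δ 2 ν := (hIp 2).sub (memLp_const p)
  have hξ0 : ∫ z, ξ z ∂ν = 0 := by
    rw [hξ, integral_sub (((hUn 1).integrable le_rfl).div_const _)
      (((hUp 1).integrable le_rfl).div_const _), integral_div, integral_div, hPi, hNi]
    simp
  have hδ0 : ∫ z, δ z ∂ν = 0 := by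
    rw [hδ, integral_sub ((hIp 1).integrable le_rfl) (integrable_const _), hPn]
    simp
  have hξ2 : ∫ z, ξ z ^ 2 ∂ν ≤ σ ^ 2 / (p * (1 - p)) := by
    have : ∀ z, ξ z ^ 2 = (if z.2 = -1 then (h z.1 - μneg) ^ 2 else 0) / (1 - p) ^ 2
        + (if z.2 = 1 then (h z.1 - μpos) ^ 2 else 0) / p ^ 2 := by
      intro z
      simp only [hξ]
      by_cases h1 : z.2 = 1
      · simp [h1, div_pow]
      · simp only [h1, if_false]; split_ifs <;> simp [div_pow]
    simp_rw [this]
    rw [integral_add (((hVn 1).integrable le_rfl).div_const _)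
      (((hVp 1).integrable le_rfl).div_const _), integral_div, integral_div]
    calc _ ≤ ((1 - p) * σ ^ 2) / (1 - p) ^ 2 + (p * σ ^ 2) / p ^ 2 := by gcongr
      _ = _ := by field_simp; ring
  have hδ2 : ∫ z, δ z ^ 2 ∂ν = p * (1 - p) := by
    have : ∀ z, δ z ^ 2 = (1 - 2 * p) * (if z.2 = 1 then (1 : ℝ) else 0) + p ^ 2 := by
      intro z
      simp only [hδ]
      split_ifs <;> ring
    simp_rw [this]
    rw [integral_add (((hIp 1).integrable le_rfl).const_mul _) (integrable_const _),
      integral_const_mul, hPn]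
    simp; ring
  obtain ⟨hξI, hξE⟩ := aux_second ν m ξ hξL hξ0
  obtain ⟨hδI, hδE⟩ := aux_second ν m δ hδL hδ0
  have hpt : ∀ᵐ ω ∂(Measure.pi fun _ : Fin m => ν), (m : ℝ) ^ 2 * (alphabar ω - (μneg - μpos)) ^ 2
      ≤ 2 * (∑ i, ξ (ω i)) ^ 2 + 2 / (p * (1 - p)) ^ 2 * (∑ i, δ (ω i)) ^ 2 := by
    filter_upwards [haepi] with ω hω
    obtain ⟨hb, hSb⟩ := aux_avg m (fun i => (ω i).2 = 1) (fun i => h (ω i).1) (Apos ω) μpos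
      (fun i => hh0 _) (fun i => hh1 _) hP0 hP1 (hApos ω) (hApos0 ω)
    obtain ⟨ha, hSa⟩ := aux_avg m (fun i => (ω i).2 = -1) (fun i => h (ω i).1) (Aneg ω) μneg
      (fun i => hh0 _) (fun i => hh1 _) hN0 hN1 (hAneg ω) (hAneg0 ω)
    have hM : ∑ i, (if (ω i).2 = -1 then (1 : ℝ) else 0)
        = m - ∑ i, (if (ω i).2 = 1 then (1 : ℝ) else 0) := by
      rw [Finset.sum_congr rfl fun i _ => hω i, Finset.sum_sub_distrib]
      simp
    have k := aux_alg m p _ _ _ _ hp0 hp1 ha hb hM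
    have e1 : ∑ i, ξ (ω i) = (∑ i, (if (ω i).2 = -1 then (1 : ℝ) else 0)) * (Aneg ω - μneg) / (1 - p)
        - (∑ i, (if (ω i).2 = 1 then (1 : ℝ) else 0)) * (Apos ω - μpos) / p := by
      rw [← hSa, ← hSb, Finset.sum_div, Finset.sum_div, ← Finset.sum_sub_distrib]
    have e2 : ∑ i, δ (ω i) = ∑ i, (if (ω i).2 = 1 then (1 : ℝ) else 0) - m * p := by
      simp only [hδ]
      rw [Finset.sum_sub_distrib]; simp
    rw [e1, e2, halpha]
    convert k using 3
    ring
  have hI := integral_mono_of_nonneg (.of_forall fun ω => by positivity)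
    ((hξI.const_mul 2).add (hδI.const_mul (2 / (p * (1 - p)) ^ 2))) hpt
  rw [integral_const_mul] at hI
  simp only [Pi.add_apply] at hI
  rw [integral_add (hξI.const_mul 2) (hδI.const_mul _), integral_const_mul, integral_const_mul,
    hξE, hδE, hδ2] at hI
  have hC := aux_C p hp0 hp1
  generalize (2 / Real.log (1 / max p (1 - p)))
            * (max p (1 - p)) ^ (1 / Real.log (1 / max p (1 - p))) = C at *
  generalize ∫ ω, (alphabar ω - (μneg - μpos)) ^ 2 ∂(Measure.pi fun _ : Fin m => ν) = E at *
  have h1 : (m : ℝ) ^ 2 * E ≤ 2 * (m * (σ ^ 2 / (p * (1 - p)))) +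
      2 / (p * (1 - p)) ^ 2 * (m * (p * (1 - p))) := hI.trans (by gcongr)
  have h2 : 2 * (m * (σ ^ 2 / (p * (1 - p)))) +
      2 / (p * (1 - p)) ^ 2 * (m * (p * (1 - p))) = m ^ 2 * (2 * (σ ^ 2 + 1) / (m * p * (1 - p))) := by
    field_simp
  rw [h2] at h1
  refine (le_of_mul_le_mul_left h1 (by positivity)).trans ?_
  gcongr
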